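/- Let 2 ≤ p < ∞ be fixed, and let (A_d), (B_d) be positive reals with limsup_{d→∞} min{√d·A_d, d·B_d} > 0. Then the curse of dimensionality holds for numerical integration on the classes C¹_d(A_d,B_d,D_p^d): there exist constants c > 0, γ > 0 and ε₀ ∈ (0,1) such that for infinitely many d ∈ ℕ, for every n ∈ ℕ with n < c·(1+γ)^d, every choice of points x₁,…,x_n ∈ D_p^d and every map φ : ℝⁿ → ℝ, there exists f ∈ C¹_d(A_d,B_d,D_p^d) with |∫_{D_p^d} f(x) dx − φ(f(x₁),…,f(x_n))| ≥ ε₀. -/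

import Mathlib

open MeasureTheory Filter
open scoped Pointwise

noncomputable section

/-- The unit ball of `ℓ_p^d`, as a subset of Euclidean space. -/
def lpBall (d : ℕ) (p : ℝ) : Set (EuclideanSpace ℝ (Fin d)) :=
  {x | ∑ i, |x i| ^ p ≤ 1}

/-- `α_{d,p} = vol_d(B_p^d)^{-1/d}`, the normalizing factor. -/
def alphadp (d : ℕ) (p : ℝ) : ℝ :=
  (volume (lpBall d p)).toReal ^ (-(1 / (d : ℝ)))

/-- The volume-normalized `ℓ_p`-ball `D_p^d = α_{d,p} · B_p^d`. -/
def lpNormalizedBall (d : ℕ) (p : ℝ) : Set (EuclideanSpace ℝ (Fin d)) :=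
  alphadp d p • lpBall d p

/-- The class `C¹_d(A, B, K)` of continuously differentiable functions `f : ℝ^d → ℝ`
with `|f| ≤ 1` on `K`, `f` being `A`-Lipschitz on `K` and its gradient `B`-Lipschitz on `K`. -/
def MemC1Class (d : ℕ) (A B : ℝ) (K : Set (EuclideanSpace ℝ (Fin d)))
    (f : EuclideanSpace ℝ (Fin d) → ℝ) : Prop :=
  ContDiff ℝ 1 f ∧ (∀ x ∈ K, |f x| ≤ 1) ∧
    (∀ x ∈ K, ∀ y ∈ K, |f x - f y| ≤ A * ‖x - y‖) ∧
    (∀ x ∈ K, ∀ y ∈ K, ‖fderiv ℝ f x - fderiv ℝ f y‖ ≤ B * ‖x - y‖)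

/-- Fooling function: squared distance to a compact convex set. -/
lemma exists_sqdist {E : Type*} [NormedAddCommGroup E] [InnerProductSpace ℝ E]
    (K : Set E) (hne : K.Nonempty) (hc : IsComplete K) (hK : Convex ℝ K) :
    ∃ P : E → E, (∀ x, P x ∈ K) ∧ (∀ x, ∀ z ∈ K, ‖x - P x‖ ≤ ‖x - z‖) ∧
      (∀ x y, ‖(x - P x) - (y - P y)‖ ≤ ‖x - y‖) ∧
      (∀ x, HasFDerivAt (fun x => ‖x - P x‖ ^ 2) ((2 : ℝ) • innerSL ℝ (x - P x)) x) := by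
  have h1 := exists_norm_eq_iInf_of_complete_convex hne hc hK
  choose P hP hmin using h1
  have hin : ∀ x, ∀ z ∈ K, inner ℝ (x - P x) (z - P x) ≤ 0 := fun x =>
    (norm_eq_iInf_iff_real_inner_le_zero hK (hP x)).1 (hmin x)
  have hle : ∀ x, ∀ z ∈ K, ‖x - P x‖ ≤ ‖x - z‖ := by
    intro x z hz
    rw [hmin x]
    exact ciInf_le ⟨0, Set.forall_mem_range.2 fun _ => norm_nonneg _⟩ (⟨z, hz⟩ : K)
  -- monotonicity
  have hmono : ∀ x y, ‖(x - P x) - (y - P y)‖ ^ 2 ≤ inner ℝ ((x - P x) - (y - P y)) (x - y) := by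
    intro x y
    have a := hin x (P y) (hP y)
    have b := hin y (P x) (hP x)
    have e : x - y = ((x - P x) - (y - P y)) + (P x - P y) := by abel
    rw [← real_inner_self_eq_norm_sq]
    have e3 : inner ℝ ((x - P x) - (y - P y)) (x - y) = inner ℝ ((x - P x) - (y - P y)) ((x - P x) - (y - P y)) + inner ℝ ((x - P x) - (y - P y)) (P x - P y) := by
      rw [← inner_add_right, ← e]
    have e2 : inner ℝ ((x - P x) - (y - P y)) (P x - P y)
      = - inner ℝ (x - P x) (P y - P x) - inner ℝ (y - P y) (P x - P y) := by
      rw [inner_sub_left, ← inner_neg_right, neg_sub]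
    linarith
  have hlip : ∀ x y, ‖(x - P x) - (y - P y)‖ ≤ ‖x - y‖ := by
    intro x y
    have h1 := hmono x y
    have h2 := real_inner_le_norm ((x - P x) - (y - P y)) (x - y)
    by_contra! h
    have := norm_nonneg (x - y)
    nlinarith
  refine ⟨P, hP, hle, hlip, fun x => ?_⟩
  have hup : ∀ x y, ‖y - P y‖ ^ 2 ≤ ‖x - P x‖ ^ 2 + 2 * inner ℝ (x - P x) (y - x)
      + ‖y - x‖ ^ 2 := by
    intro x y
    have h := hle y (P x) (hP x)
    have e : y - P x = (x - P x) + (y - x) := by abel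
    calc ‖y - P y‖ ^ 2 ≤ ‖y - P x‖ ^ 2 := by gcongr
      _ = _ := by rw [e, norm_add_sq_real]
  have hlow : ∀ x y, ‖x - P x‖ ^ 2 + 2 * inner ℝ (x - P x) (y - x) - ‖y - x‖ ^ 2
      ≤ ‖y - P y‖ ^ 2 := by
    intro x y
    have h1 := hup y x
    have h2 := hmono y x
    have h3 := sq_nonneg ‖(y - P y) - (x - P x)‖
    rw [inner_sub_left] at h2
    have e : inner ℝ (y - P y) (x - y) = - inner ℝ (y - P y) (y - x) := by
      rw [← inner_neg_right, neg_sub]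
    rw [norm_sub_rev x y] at h1
    linarith
  rw [hasFDerivAt_iff_isLittleO]
  have hO : (fun y => ‖y - P y‖ ^ 2 - ‖x - P x‖ ^ 2
      - ((2 : ℝ) • innerSL ℝ (x - P x)) (y - x)) =O[nhds x] fun y => ‖y - x‖ ^ 2 := by
    refine Asymptotics.IsBigO.of_bound 1 (Eventually.of_forall fun y => ?_)
    rw [Real.norm_eq_abs, Real.norm_of_nonneg (by positivity), one_mul, abs_le]
    have h1 := hup x y
    have h2 := hlow x y
    simp only [smul_apply, innerSL_apply_apply, smul_eq_mul]
    constructor <;> linarith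
  refine hO.trans_isLittleO ?_
  have := Asymptotics.isLittleO_pow_id (𝕜 := ℝ) (n := 2) one_lt_two
  have t : Tendsto (fun y => ‖y - x‖) (nhds x) (nhds 0) := by
    have : Continuous fun y => ‖y - x‖ := by fun_prop
    simpa using this.tendsto x
  have h := this.comp_tendsto t
  exact Asymptotics.IsLittleO.of_norm_right (by simpa [Function.comp_def] using h)

lemma subgauss (p : ℝ) (hp : 2 ≤ p) (a : ℝ) (ha : 0 < a) :
    ∃ C > (0 : ℝ), ∀ u : ℝ, Integrable (fun y : ℝ => Real.exp (-a * |y| ^ p + u * y)) ∧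
      ∫ y : ℝ, Real.exp (-a * |y| ^ p + u * y) ≤
        (∫ y : ℝ, Real.exp (-a * |y| ^ p)) * Real.exp (C * u ^ 2) := by
  have hpow : ∀ y : ℝ, y ^ 2 - 1 ≤ |y| ^ p := by
    intro y
    rcases le_total |y| 1 with h | h
    · have : y ^ 2 ≤ 1 := by rw [← sq_abs]; exact pow_le_one₀ (abs_nonneg _) h
      have := Real.rpow_nonneg (abs_nonneg y) p
      linarith
    · have := Real.rpow_le_rpow_of_exponent_le h hp
      rw [Real.rpow_two, sq_abs] at this
      linarith
  have hmeas : ∀ u s : ℝ, AEStronglyMeasurable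
      (fun y : ℝ => Real.exp (-a * |y| ^ p + u * y + s * y ^ 2)) volume := by
    intro u s
    apply Measurable.aestronglyMeasurable
    fun_prop
  -- basic integrability
  have hint : ∀ u : ℝ, Integrable (fun y : ℝ => Real.exp (-a * |y| ^ p + u * y + a / 2 * y ^ 2)) := by
    intro u
    have h1 := (integrable_exp_neg_mul_sq (b := a / 4) (by positivity)).const_mul
      (Real.exp (a + u ^ 2 / a))
    refine h1.mono' (hmeas u _) (Eventually.of_forall fun y => ?_)
    rw [Real.norm_of_nonneg (Real.exp_nonneg _), ← Real.exp_add]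
    apply Real.exp_le_exp.2
    have h2 := mul_le_mul_of_nonneg_left (hpow y) ha.le
    have h3 : u * y ≤ u ^ 2 / a + a / 4 * y ^ 2 := by
      have : u ^ 2 / a + a / 4 * y ^ 2 - u * y = (u - a / 2 * y) ^ 2 / a := by
        field_simp; ring
      have h4 : 0 ≤ (u - a / 2 * y) ^ 2 / a := by positivity
      linarith
    nlinarith
  have hint0 : ∀ u : ℝ, Integrable (fun y : ℝ => Real.exp (-a * |y| ^ p + u * y)) := by
    intro u
    refine (hint u).mono' (by simpa using hmeas u 0) (Eventually.of_forall fun y => ?_)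
    rw [Real.norm_of_nonneg (Real.exp_nonneg _)]
    apply Real.exp_le_exp.2
    have : 0 ≤ a / 2 * y ^ 2 := by positivity
    linarith
  have hg : Integrable (fun y : ℝ => Real.exp (-a * |y| ^ p)) := by simpa using hint0 0
  have hgs : Integrable (fun y : ℝ => Real.exp (-a * |y| ^ p + a / 2 * y ^ 2)) := by
    simpa using hint 0
  set I := ∫ y : ℝ, Real.exp (-a * |y| ^ p) with hI
  set M' := ∫ y : ℝ, Real.exp (-a * |y| ^ p + a / 2 * y ^ 2) with hM'
  have hIpos : 0 < I := integral_exp_pos hg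
  have hMpos : 0 < M' := integral_exp_pos hgs
  have hM : M' = I * (M' / I) := by field_simp
  set M := M' / I with hMdef
  have hM0 : 0 < M := by positivity
  refine ⟨(M + 1 / 2) / a, by positivity, fun u => ⟨hint0 u, ?_⟩⟩
  -- symmetrization
  have hsym : ∫ y : ℝ, Real.exp (-a * |y| ^ p + u * y) =
      ∫ y : ℝ, Real.exp (-a * |y| ^ p) * Real.cosh (u * y) := by
    have e1 : ∫ y : ℝ, Real.exp (-a * |y| ^ p + u * y) =
        ∫ y : ℝ, Real.exp (-a * |y| ^ p + (-u) * y) := by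
      rw [← integral_neg_eq_self]
      simp
    have e2 : ∫ y : ℝ, Real.exp (-a * |y| ^ p) * Real.cosh (u * y) =
        ∫ y : ℝ, ((1 / 2) * Real.exp (-a * |y| ^ p + u * y)
          + (1 / 2) * Real.exp (-a * |y| ^ p + (-u) * y)) := by
      congr 1; ext y
      rw [Real.cosh_eq, Real.exp_add, Real.exp_add, neg_mul u y]
      ring
    rw [e2, integral_add ((hint0 u).const_mul _) ((hint0 (-u)).const_mul _),
      integral_const_mul, integral_const_mul, ← e1]
    ring
  have hcint : Integrable (fun y : ℝ => Real.exp (-a * |y| ^ p) * Real.cosh (u * y)) := by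
    have := ((hint0 u).const_mul (1/2)).add ((hint0 (-u)).const_mul (1/2))
    refine this.congr (Eventually.of_forall fun y => ?_)
    simp only [Pi.add_apply]
    rw [Real.cosh_eq, Real.exp_add, Real.exp_add, neg_mul u y]
    ring
  rw [hsym]
  set τ := u ^ 2 / a with hτ
  have hτ0 : 0 ≤ τ := by positivity
  have hua : u ^ 2 = τ * a := by rw [hτ]; field_simp
  have hCu : (M + 1 / 2) / a * u ^ 2 = (M + 1 / 2) * τ := by rw [hτ]; field_simp
  rw [hCu]
  rcases le_total τ 1 with h | h
  · calc ∫ y : ℝ, Real.exp (-a * |y| ^ p) * Real.cosh (u * y)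
        ≤ ∫ y : ℝ, (Real.exp (-a * |y| ^ p) + τ * Real.exp (-a * |y| ^ p + a / 2 * y ^ 2)) := by
          refine integral_mono hcint (hg.add (hgs.const_mul _)) fun y => ?_
          have h1 : Real.cosh (u * y) ≤ 1 + τ * Real.exp (a / 2 * y ^ 2) := by
            refine (Real.cosh_le_exp_half_sq _).trans ?_
            have hc := convexOn_exp.2 (Set.mem_univ 0) (Set.mem_univ (a / 2 * y ^ 2))
              (sub_nonneg.2 h) hτ0 (by ring)
            simp only [smul_eq_mul, mul_zero, zero_add, Real.exp_zero, mul_one] at hc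
            have : (u * y) ^ 2 / 2 = τ * (a / 2 * y ^ 2) := by rw [mul_pow, hua]; ring
            rw [this]
            linarith
          simp only
          rw [Real.exp_add]
          have := mul_le_mul_of_nonneg_left h1 (Real.exp_nonneg (-a * |y| ^ p))
          linarith
      _ = I + τ * M' := by
          rw [integral_add hg (hgs.const_mul _), integral_const_mul]
      _ = I * (1 + M * τ) := by rw [hM]; ring
      _ ≤ I * Real.exp ((M + 1 / 2) * τ) := by
          gcongr
          have := Real.add_one_le_exp ((M + 1 / 2) * τ)
          linarith
  · calc ∫ y : ℝ, Real.exp (-a * |y| ^ p) * Real.cosh (u * y)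
        ≤ ∫ y : ℝ, Real.exp (τ / 2) * Real.exp (-a * |y| ^ p + a / 2 * y ^ 2) := by
          refine integral_mono hcint (hgs.const_mul _) fun y => ?_
          have h1 : Real.cosh (u * y) ≤ Real.exp (τ / 2 + a / 2 * y ^ 2) := by
            have habs : |u * y| ≤ τ / 2 + a / 2 * y ^ 2 := by
              have e : τ / 2 + a / 2 * y ^ 2 - u * y = (u - a * y) ^ 2 / (2 * a) := by
                rw [hτ]; field_simp; ring
              have e' : τ / 2 + a / 2 * y ^ 2 + u * y = (u + a * y) ^ 2 / (2 * a) := by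
                rw [hτ]; field_simp; ring
              have e1 : 0 ≤ (u - a * y) ^ 2 / (2 * a) := by positivity
              have e2 : 0 ≤ (u + a * y) ^ 2 / (2 * a) := by positivity
              rw [abs_le]; constructor <;> linarith
            rw [← Real.cosh_abs, Real.cosh_eq]
            have := Real.exp_le_exp.2 habs
            have := Real.exp_le_exp.2 (show -|u * y| ≤ |u * y| by linarith [abs_nonneg (u * y)])
            linarith
          simp only
          rw [Real.exp_add] at h1
          rw [Real.exp_add]
          have := mul_le_mul_of_nonneg_left h1 (Real.exp_nonneg (-a * |y| ^ p))
          linarith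
      _ = Real.exp (τ / 2) * (I * M) := by rw [integral_const_mul, ← hM]
      _ ≤ Real.exp (τ / 2) * (I * Real.exp (M * τ)) := by
          gcongr
          have := Real.add_one_le_exp (M * τ)
          nlinarith
      _ = I * Real.exp ((M + 1 / 2) * τ) := by
          rw [show (M + 1 / 2) * τ = τ / 2 + M * τ by ring, Real.exp_add]; ring

lemma gamma_bound (θ : ℝ) (h0 : 0 < θ) (h1 : θ < 1) (N : ℝ) (hN : 0 < N) :
    Real.Gamma (N + 1) ≤ (N / θ * Real.exp (-1)) ^ N * (1 - θ)⁻¹ := by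
  rw [Real.Gamma_eq_integral (by linarith)]
  have hI := integrableOn_exp_mul_Ioi (a := -(1 - θ)) (by linarith) 0
  calc ∫ x in Set.Ioi (0 : ℝ), Real.exp (-x) * x ^ (N + 1 - 1)
      ≤ ∫ x in Set.Ioi (0 : ℝ), (N / θ * Real.exp (-1)) ^ N * Real.exp (-(1 - θ) * x) := by
        refine setIntegral_mono_on (Real.GammaIntegral_convergent (by linarith))
          (hI.const_mul _) measurableSet_Ioi fun x hx => ?_
        have hx : 0 < x := hx
        have hb : x ≤ N / θ * Real.exp (-1) * Real.exp (θ * x / N) := by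
          have := Real.add_one_le_exp (θ * x / N - 1)
          rw [mul_assoc, ← Real.exp_add]
          have h2 : θ * x / N ≤ Real.exp (-1 + θ * x / N) := by
            rw [show -1 + θ * x / N = θ * x / N - 1 by ring]; linarith
          calc x = N / θ * (θ * x / N) := by field_simp
            _ ≤ _ := by gcongr
        have hb2 := Real.rpow_le_rpow hx.le hb hN.le
        rw [Real.mul_rpow (by positivity) (by positivity), ← Real.exp_mul] at hb2
        rw [show N + 1 - 1 = N by ring]
        calc Real.exp (-x) * x ^ N
            ≤ Real.exp (-x) * ((N / θ * Real.exp (-1)) ^ N * Real.exp (θ * x / N * N)) := by gcongr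
          _ = _ := by
            rw [show -(1 - θ) * x = -x + θ * x / N * N by field_simp; ring, Real.exp_add]
            ring
    _ = _ := by
        rw [integral_const_mul, integral_exp_mul_Ioi (by linarith)]
        rw [mul_zero, Real.exp_zero, neg_div_neg_eq, one_div]

lemma gamma_root (η : ℝ) (hη : 0 < η) : ∀ᶠ N : ℝ in atTop,
    Real.exp 1 * Real.Gamma (N + 1) ^ (1 / N) ≤ (1 + η) * N := by
  set θ := 1 / Real.sqrt (1 + η) with hθ
  have hs : 1 < Real.sqrt (1 + η) := by
    rw [Real.lt_sqrt (by norm_num)]; linarith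
  have h0 : 0 < θ := by positivity
  have h1 : θ < 1 := by rw [hθ, div_lt_one (by positivity)]; exact hs
  have ht : Tendsto (fun N : ℝ => ((1 - θ)⁻¹) ^ (1 / N)) atTop (nhds 1) := by
    have hz : Tendsto (fun N : ℝ => 1 / N) atTop (nhds 0) := by
      simpa using tendsto_inv_atTop_zero (𝕜 := ℝ)
    have hcont : Continuous (fun z : ℝ => ((1 - θ)⁻¹) ^ z) :=
      Real.continuous_const_rpow (inv_ne_zero (by linarith))
    have := (hcont.tendsto 0).comp hz
    simpa [Function.comp_def] using this
  filter_upwards [ht.eventually (gt_mem_nhds hs), eventually_gt_atTop 0] with N hN hN0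
  have hg := gamma_bound θ h0 h1 N hN0
  have hp : 0 ≤ (1 - θ)⁻¹ := inv_nonneg.2 (by linarith)
  have hg2 : Real.Gamma (N + 1) ^ (1 / N) ≤ N / θ * Real.exp (-1) * Real.sqrt (1 + η) := by
    calc Real.Gamma (N + 1) ^ (1 / N)
        ≤ ((N / θ * Real.exp (-1)) ^ N * (1 - θ)⁻¹) ^ (1 / N) :=
          Real.rpow_le_rpow (Real.Gamma_pos_of_pos (by linarith)).le hg (by positivity)
      _ = N / θ * Real.exp (-1) * ((1 - θ)⁻¹) ^ (1 / N) := by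
          rw [Real.mul_rpow (by positivity) hp, ← Real.rpow_mul (by positivity),
            mul_one_div_cancel hN0.ne', Real.rpow_one]
      _ ≤ _ := by gcongr
  calc Real.exp 1 * Real.Gamma (N + 1) ^ (1 / N)
      ≤ Real.exp 1 * (N / θ * Real.exp (-1) * Real.sqrt (1 + η)) := by gcongr
    _ = (Real.exp 1 * Real.exp (-1)) * (Real.sqrt (1 + η) * Real.sqrt (1 + η)) * N := by
        rw [hθ]; field_simp
    _ = _ := by
        rw [← Real.exp_add, Real.mul_self_sqrt (by linarith)]; simp

lemma int_g (p : ℝ) (hp : 2 ≤ p) :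
    ∫ y : ℝ, Real.exp (-(Real.exp 1 * (2 * Real.Gamma (1 / p + 1)) ^ p) * |y| ^ p)
      = Real.exp (-(1 / p)) := by
  have hG : 0 < Real.Gamma (1 / p + 1) := Real.Gamma_pos_of_pos (by positivity)
  have hp0 : 0 < p := by linarith
  rw [integral_comp_abs (f := fun y : ℝ =>
    Real.exp (-(Real.exp 1 * (2 * Real.Gamma (1 / p + 1)) ^ p) * y ^ p)),
    integral_exp_neg_mul_rpow hp0 (by positivity),
    Real.mul_rpow (by positivity) (by positivity), ← Real.rpow_mul (by positivity),
    ← Real.exp_mul, show p * (-1 / p) = -1 by field_simp, Real.rpow_neg_one,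
    show (1 : ℝ) * (-1 / p) = -(1 / p) by ring]
  field_simp

lemma vol_lpBall (d : ℕ) (hd : 0 < d) (p : ℝ) (hp : 2 ≤ p) :
    volume (lpBall d p) =
      ENNReal.ofReal ((2 * Real.Gamma (1 / p + 1)) ^ d / Real.Gamma (d / p + 1)) := by
  have : Nonempty (Fin d) := ⟨⟨0, hd⟩⟩
  have h := MeasureTheory.volume_sum_rpow_le (ι := Fin d) (p := p) (by linarith) 1
  simp only [ENNReal.ofReal_one, one_pow, one_mul, Fintype.card_fin] at h
  rw [← h]
  rw [← (PiLp.volume_preserving_ofLp (Fin d)).measure_preimage_equiv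
    (f := MeasurableEquiv.toLp 2 (Fin d → ℝ) |>.symm)]
  congr 1
  ext x
  simp only [lpBall, Set.mem_ofPred_eq, Set.mem_preimage]
  have h0 : 0 ≤ ∑ i, |x i| ^ p := Finset.sum_nonneg fun i _ => Real.rpow_nonneg (abs_nonneg _) _
  have hiff : (∑ i, |x i| ^ p) ^ (1 / p) ≤ 1 ↔ ∑ i, |x i| ^ p ≤ 1 := by
    have := Real.rpow_le_rpow_iff h0 zero_le_one (show 0 < 1 / p by positivity)
    rwa [Real.one_rpow] at this
  exact hiff.symm

lemma measurableSet_lpBall (d : ℕ) (p : ℝ) : MeasurableSet (lpBall d p) := by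
  unfold lpBall
  apply measurableSet_le <;> fun_prop

/-- Everything we need about the normalizing constant. -/
lemma alpha_facts (d : ℕ) (hd : 0 < d) (p : ℝ) (hp : 2 ≤ p) :
    0 < alphadp d p ∧ volume (lpNormalizedBall d p) = 1 ∧
    MeasurableSet (lpNormalizedBall d p) ∧
    (∀ x ∈ lpNormalizedBall d p, ∑ i, |x i| ^ p ≤ alphadp d p ^ p) ∧
    Real.exp 1 * (2 * Real.Gamma (1 / p + 1)) ^ p * alphadp d p ^ p =
      Real.exp 1 * Real.Gamma (d / p + 1) ^ (1 / (d / p)) := by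
  have hv := vol_lpBall d hd p hp
  have hG : 0 < Real.Gamma (1 / p + 1) := Real.Gamma_pos_of_pos (by positivity)
  have hG2 : 0 < Real.Gamma (d / p + 1) := Real.Gamma_pos_of_pos (by positivity)
  set V := (2 * Real.Gamma (1 / p + 1)) ^ d / Real.Gamma (d / p + 1) with hV
  have hVpos : 0 < V := by positivity
  have hd' : (0 : ℝ) < d := by exact_mod_cast hd
  have hα : alphadp d p = V ^ (-(1 / (d : ℝ))) := by
    unfold alphadp
    rw [hv, ENNReal.toReal_ofReal hVpos.le]
  have hαpos : 0 < alphadp d p := by rw [hα]; positivity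
  refine ⟨hαpos, ?_, ?_, ?_, ?_⟩
  · unfold lpNormalizedBall
    rw [Measure.addHaar_smul, hv, finrank_euclideanSpace_fin,
      ← ENNReal.ofReal_mul (abs_nonneg _), abs_of_pos (by positivity), hα,
      ← Real.rpow_natCast, ← Real.rpow_mul hVpos.le,
      show -(1 / (d : ℝ)) * d = -1 by field_simp, Real.rpow_neg_one,
      inv_mul_cancel₀ hVpos.ne', ENNReal.ofReal_one]
  · exact (measurableSet_lpBall d p).const_smul₀ _
  · rintro x ⟨y, hy, rfl⟩
    have hy : ∑ i, |y i| ^ p ≤ 1 := hy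
    simp only [PiLp.smul_apply, smul_eq_mul, abs_mul, abs_of_pos hαpos]
    calc ∑ i, (alphadp d p * |y i|) ^ p = alphadp d p ^ p * ∑ i, |y i| ^ p := by
          rw [Finset.mul_sum]
          exact Finset.sum_congr rfl fun i _ => Real.mul_rpow hαpos.le (abs_nonneg _)
      _ ≤ alphadp d p ^ p * 1 := by gcongr
      _ = _ := mul_one _
  · have hp0 : 0 < p := by linarith
    rw [hα, ← Real.rpow_mul hVpos.le, hV, Real.div_rpow (by positivity) hG2.le,
      ← Real.rpow_natCast, ← Real.rpow_mul (by positivity),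
      show (d : ℝ) * (-(1 / (d : ℝ)) * p) = -p by field_simp,
      show (-(1 / (d : ℝ)) * p) = -(1 / (d / p)) by field_simp,
      Real.rpow_neg (by positivity), Real.rpow_neg hG2.le]
    have : 0 < (2 * Real.Gamma (1 / p + 1)) ^ p := by positivity
    field_simp

lemma markov_prod (d : ℕ) (S : Set (EuclideanSpace ℝ (Fin d)))
    (F : Fin d → ℝ → ℝ) (hF : ∀ i, Integrable (F i)) (hF0 : ∀ i y, 0 ≤ F i y) (k : ℝ) (hk : 0 ≤ k)
    (hS : ∀ x ∈ S, 1 ≤ k * ∏ i, F i (x i)) :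
    volume S ≤ ENNReal.ofReal (k * ∏ i, ∫ y, F i y) := by
  have hint : Integrable (fun x : Fin d → ℝ => k * ∏ i, F i (x i)) :=
    (Integrable.fintype_prod hF).const_mul k
  have hmp := PiLp.volume_preserving_ofLp (Fin d)
  have hmp' := EuclideanSpace.volume_preserving_symm_measurableEquiv_toLp (Fin d)
  have hint2 : Integrable (fun x : EuclideanSpace ℝ (Fin d) => k * ∏ i, F i (x i)) :=
    hmp.integrable_comp_of_integrable hint
  have hval : ∫ x : EuclideanSpace ℝ (Fin d), k * ∏ i, F i (x i) = k * ∏ i, ∫ y, F i y := by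
    have := hmp'.integral_comp (MeasurableEquiv.measurableEmbedding _)
      (fun x : Fin d → ℝ => k * ∏ i, F i (x i))
    refine Eq.trans this ?_
    rw [integral_const_mul, integral_fintype_prod_volume_eq_prod]
  rw [← hval, ofReal_integral_eq_lintegral_ofReal hint2
    (Eventually.of_forall fun x => mul_nonneg hk (Finset.prod_nonneg fun i _ => hF0 i _))]
  have hm : AEMeasurable (fun x : EuclideanSpace ℝ (Fin d) =>
    ENNReal.ofReal (k * ∏ i, F i (x i))) := hint2.aestronglyMeasurable.aemeasurable.ennreal_ofReal
  have := mul_meas_ge_le_lintegral₀ hm 1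
  rw [one_mul] at this
  refine (measure_mono fun x hx => ?_).trans this
  simpa using ENNReal.ofReal_le_ofReal (hS x hx)

lemma cap_bound (p a C : ℝ) (I : ℝ)
    (hC : ∀ u : ℝ, Integrable (fun y : ℝ => Real.exp (-a * |y| ^ p + u * y)) ∧
      ∫ y : ℝ, Real.exp (-a * |y| ^ p + u * y) ≤ Real.exp I * Real.exp (C * u ^ 2))
    (ha : 0 < a) (d : ℕ) (D : Set (EuclideanSpace ℝ (Fin d))) (L : ℝ)
    (hD : ∀ x ∈ D, ∑ i, |x i| ^ p ≤ L) (x : EuclideanSpace ℝ (Fin d)) (l t : ℝ) (hl : 0 ≤ l) :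
    volume {y ∈ D | t ≤ inner ℝ x y} ≤
      ENNReal.ofReal (Real.exp (a * L - l * t + d * I + C * l ^ 2 * ‖x‖ ^ 2)) := by
  refine (markov_prod d _ (fun i y => Real.exp (-a * |y| ^ p + (l * x i) * y))
    (fun i => (hC _).1) (fun _ _ => Real.exp_nonneg _) (Real.exp (a * L - l * t))
    (Real.exp_nonneg _) ?_).trans (ENNReal.ofReal_le_ofReal ?_)
  · rintro y ⟨hy, hty⟩
    rw [← Real.exp_sum, ← Real.exp_add]
    apply Real.one_le_exp
    have h1 := hD y hy
    have h2 : inner ℝ x y = ∑ i, x i * y i := by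
      rw [PiLp.inner_apply]
      exact Finset.sum_congr rfl fun i _ => by simp [mul_comm]
    have h3 : ∑ i, (-a * |y i| ^ p + l * x i * y i) =
        -a * ∑ i, |y i| ^ p + l * inner ℝ x y := by
      rw [h2, Finset.sum_add_distrib, Finset.mul_sum, Finset.mul_sum]
      simp only [mul_assoc]
    rw [h3]
    have := mul_le_mul_of_nonneg_left h1 ha.le
    have := mul_le_mul_of_nonneg_left hty hl
    linarith
  · have h1 : ∏ i, ∫ y : ℝ, Real.exp (-a * |y| ^ p + (l * x i) * y) ≤
        ∏ i : Fin d, (Real.exp I * Real.exp (C * (l * x i) ^ 2)) :=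
      Finset.prod_le_prod (fun i _ => integral_nonneg fun y => Real.exp_nonneg _)
        (fun i _ => (hC _).2)
    have h2 : ∏ i : Fin d, (Real.exp I * Real.exp (C * (l * x i) ^ 2)) =
        Real.exp (d * I + C * l ^ 2 * ‖x‖ ^ 2) := by
      simp only [← Real.exp_add]
      rw [← Real.exp_sum, Finset.sum_add_distrib, EuclideanSpace.norm_sq_eq, Finset.mul_sum]
      simp [mul_pow, mul_assoc]
    calc _ ≤ Real.exp (a * L - l * t) * Real.exp (d * I + C * l ^ 2 * ‖x‖ ^ 2) := by
          rw [← h2]; gcongr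
      _ = _ := by rw [← Real.exp_add]; ring_nf

lemma small_ball (d : ℕ) (hd : 0 < d) :
    volume {y : EuclideanSpace ℝ (Fin d) | ‖y‖ ^ 2 < 1 / (16 * Real.exp 1 ^ 2 * Real.pi) * d} ≤
      ENNReal.ofReal (1 / 4) := by
  set m := 1 / (16 * Real.exp 1 ^ 2 * Real.pi) with hm
  have hpi := Real.pi_pos
  have hm0 : 0 < m := by positivity
  refine (markov_prod d _ (fun i y => Real.exp (-(1 / m) * y ^ 2))
    (fun i => integrable_exp_neg_mul_sq (by positivity)) (fun _ _ => Real.exp_nonneg _)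
    (Real.exp d) (Real.exp_nonneg _) ?_).trans (ENNReal.ofReal_le_ofReal ?_)
  · intro y hy
    have hy : ‖y‖ ^ 2 < m * d := hy
    rw [← Real.exp_sum, ← Real.exp_add]
    apply Real.one_le_exp
    rw [← Finset.mul_sum]
    have : ‖y‖ ^ 2 = ∑ i, y i ^ 2 := by simp [EuclideanSpace.norm_sq_eq]
    rw [← this]
    have h2 : 1 / m * ‖y‖ ^ 2 ≤ 1 / m * (m * d) := by gcongr
    have h3 : 1 / m * (m * d) = d := by field_simp
    linarith
  · simp only [integral_gaussian, Finset.prod_const, Finset.card_univ, Fintype.card_fin]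
    have h1 : Real.pi / (1 / m) = (Real.exp (-1) / 4) ^ 2 := by
      rw [hm, Real.exp_neg]; field_simp; norm_num
    rw [h1, Real.sqrt_sq (by positivity)]
    have h2 : Real.exp d = Real.exp 1 ^ d := by rw [← Real.exp_nat_mul, mul_one]
    rw [h2, ← mul_pow, show Real.exp 1 * (Real.exp (-1) / 4) = 1 / 4 by
      rw [Real.exp_neg]; field_simp]
    exact pow_le_of_le_one (by norm_num) (by norm_num) hd.ne'

lemma fooling (d : ℕ) (hd : 0 < d) (D : Set (EuclideanSpace ℝ (Fin d))) (hDm : MeasurableSet D)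
    (hDv : volume D = 1) (R m ρ a b : ℝ) (hR : 1 ≤ R) (hm : 0 < m) (hρ : 0 < ρ)
    (hDR : ∀ x ∈ D, ‖x‖ ^ 2 ≤ R * d)
    (ha : ρ ≤ Real.sqrt d * a) (hb : ρ ≤ d * b)
    (n : ℕ) (pts : Fin n → EuclideanSpace ℝ (Fin d))
    (hbad : volume {y : EuclideanSpace ℝ (Fin d) | ‖y‖ ^ 2 < m * d} ≤ ENNReal.ofReal (1 / 4))
    (hcap : ∑ i, volume {y ∈ D | m * d / 2 ≤ inner ℝ (pts i) y} ≤ ENNReal.ofReal (1 / 4))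
    (β : ℝ) (hβ : 0 < β) (hβ1 : β * R ≤ 1) (hβ2 : 2 * β * R ≤ ρ) :
    ∃ f : EuclideanSpace ℝ (Fin d) → ℝ, MemC1Class d a b D f ∧ MemC1Class d a b D (fun x => - f x) ∧
      (∀ i, f (pts i) = 0) ∧ β * m ^ 2 / (4 * R) / 2 ≤ ∫ x in D, f x := by
  have hd' : (0 : ℝ) < d := by exact_mod_cast hd
  set K := convexHull ℝ (insert 0 (Set.range pts)) with hKdef
  have hfin : (insert 0 (Set.range pts)).Finite := (Set.finite_range pts).insert 0
  have h0K : (0 : EuclideanSpace ℝ (Fin d)) ∈ K := subset_convexHull ℝ _ (Set.mem_insert _ _)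
  have hptsK : ∀ i, pts i ∈ K := fun i =>
    subset_convexHull ℝ _ (Set.mem_insert_of_mem _ ⟨i, rfl⟩)
  obtain ⟨P, hP, hle, hlip, hder⟩ := exists_sqdist K ⟨0, h0K⟩
    (hfin.isCompact_convexHull ℝ).isComplete (convex_convexHull ℝ _)
  have hderf : ∀ x, HasFDerivAt (fun x => β / d * ‖x - P x‖ ^ 2)
      ((β / d) • ((2 : ℝ) • innerSL ℝ (x - P x))) x := fun x => (hder x).const_mul _
  set f : EuclideanSpace ℝ (Fin d) → ℝ := fun x => β / d * ‖x - P x‖ ^ 2 with hf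
  have hfd : ∀ x, fderiv ℝ f x = (β / d) • ((2 : ℝ) • innerSL ℝ (x - P x)) :=
    fun x => (hderf x).fderiv
  have hdist : ∀ x ∈ D, ‖x - P x‖ ≤ Real.sqrt (R * d) := by
    intro x hx
    refine (hle x 0 h0K).trans (Real.le_sqrt_of_sq_le ?_)
    simpa using hDR x hx
  have hdist2 : ∀ x ∈ D, ‖x - P x‖ ^ 2 ≤ R * d := by
    intro x hx
    have := hle x 0 h0K
    rw [sub_zero] at this
    exact (pow_le_pow_left₀ (norm_nonneg _) this 2).trans (hDR x hx)
  have hf0 : ∀ x, 0 ≤ f x := fun x => by rw [hf]; positivity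
  have hf1 : ∀ x ∈ D, |f x| ≤ 1 := by
    intro x hx
    rw [abs_of_nonneg (hf0 x)]
    calc f x ≤ β / d * (R * d) := by
          rw [hf]; have := hdist2 x hx; simp only; gcongr
      _ = β * R := by field_simp
      _ ≤ 1 := hβ1
  have hflip : ∀ x ∈ D, ∀ y ∈ D, |f x - f y| ≤ a * ‖x - y‖ := by
    intro x hx y hy
    have e : f x - f y = β / d * ((‖x - P x‖ + ‖y - P y‖) * (‖x - P x‖ - ‖y - P y‖)) := by
      rw [hf]; ring
    rw [e, abs_mul, abs_mul, abs_of_pos (by positivity : 0 < β / d),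
      abs_of_nonneg (by positivity : 0 ≤ ‖x - P x‖ + ‖y - P y‖)]
    have h1 : |‖x - P x‖ - ‖y - P y‖| ≤ ‖x - y‖ := (abs_norm_sub_norm_le _ _).trans (hlip x y)
    have h2 : ‖x - P x‖ + ‖y - P y‖ ≤ 2 * Real.sqrt (R * d) := by
      linarith [hdist x hx, hdist y hy]
    have h3 : Real.sqrt (R * d) ≤ R * Real.sqrt d := by
      rw [Real.sqrt_mul (by linarith)]
      gcongr
      rw [Real.sqrt_le_left (by linarith)]
      nlinarith
    have h4 : β / d * (2 * (R * Real.sqrt d)) ≤ a := by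
      have hs : 0 < Real.sqrt d := Real.sqrt_pos.2 hd'
      have hss : Real.sqrt d * Real.sqrt d = d := Real.mul_self_sqrt hd'.le
      have : β / d * (2 * (R * Real.sqrt d)) = 2 * β * R / Real.sqrt d := by
        nth_rewrite 1 [← hss]; field_simp
      rw [this, div_le_iff₀ hs]
      linarith
    calc β / d * ((‖x - P x‖ + ‖y - P y‖) * |‖x - P x‖ - ‖y - P y‖|)
        ≤ β / d * ((2 * (R * Real.sqrt d)) * ‖x - y‖) := by gcongr; linarith
      _ = β / d * (2 * (R * Real.sqrt d)) * ‖x - y‖ := by ring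
      _ ≤ a * ‖x - y‖ := by gcongr
  have hβd : 2 * (β / d) ≤ b := by
    rw [← mul_div_assoc, div_le_iff₀ hd']
    nlinarith
  have hfdlip : ∀ x y, ‖fderiv ℝ f x - fderiv ℝ f y‖ ≤ 2 * (β / d) * ‖x - y‖ := by
    intro x y
    rw [hfd, hfd, ← smul_sub, ← smul_sub, ← map_sub, norm_smul, norm_smul, innerSL_apply_norm,
      Real.norm_of_nonneg (by positivity), Real.norm_of_nonneg (by positivity)]
    have := hlip x y
    calc β / d * (2 * ‖x - P x - (y - P y)‖) ≤ β / d * (2 * ‖x - y‖) := by gcongr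
      _ = _ := by ring
  have hcd : ContDiff ℝ 1 f := by
    rw [contDiff_one_iff_fderiv]
    refine ⟨fun x => (hderf x).differentiableAt, ?_⟩
    have : LipschitzWith (Real.toNNReal (2 * (β / d))) (fderiv ℝ f) := by
      refine LipschitzWith.of_dist_le_mul fun x y => ?_
      rw [dist_eq_norm, dist_eq_norm, Real.coe_toNNReal _ (by positivity)]
      exact hfdlip x y
    exact this.continuous
  have hgrad : ∀ x ∈ D, ∀ y ∈ D, ‖fderiv ℝ f x - fderiv ℝ f y‖ ≤ b * ‖x - y‖ := fun x _ y _ =>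
    (hfdlip x y).trans (by gcongr)
  refine ⟨f, ⟨hcd, hf1, hflip, hgrad⟩, ⟨hcd.neg, ?_, ?_, ?_⟩, ?_, ?_⟩
  · intro x hx; rw [abs_neg]; exact hf1 x hx
  · intro x hx y hy
    have := hflip x hx y hy
    rwa [← abs_neg, show -(f x - f y) = -f x - -f y by ring] at this
  · intro x hx y hy
    have e : ∀ z, fderiv ℝ (fun x => - f x) z = - fderiv ℝ f z := fun z => fderiv_fun_neg
    rw [e, e, ← norm_neg, show -(-fderiv ℝ f x - -fderiv ℝ f y) =
      fderiv ℝ f x - fderiv ℝ f y by abel]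
    exact hgrad x hx y hy
  · intro i
    have h := hle (pts i) (pts i) (hptsK i)
    rw [sub_self, norm_zero] at h
    have h' : ‖pts i - P (pts i)‖ = 0 := le_antisymm h (norm_nonneg _)
    simp [hf, h']
  · -- the good set
    set U : Set (EuclideanSpace ℝ (Fin d)) := {y | ‖y‖ ^ 2 < m * d} ∪
      ⋃ i, {y ∈ D | m * d / 2 ≤ inner ℝ (pts i) y} with hU
    have hUm : MeasurableSet U := by
      refine MeasurableSet.union ?_ (MeasurableSet.iUnion fun i => hDm.inter ?_)
      · exact measurableSet_lt (by fun_prop) (by fun_prop)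
      · have hmi : Measurable fun y : EuclideanSpace ℝ (Fin d) => inner ℝ (pts i) y := by fun_prop
        exact measurableSet_le measurable_const hmi
    have hUv : volume U ≤ ENNReal.ofReal (1 / 2) := by
      calc volume U ≤ ENNReal.ofReal (1 / 4) + ENNReal.ofReal (1 / 4) := by
            refine (measure_union_le _ _).trans (add_le_add hbad ?_)
            refine (measure_iUnion_le _).trans ?_
            rw [tsum_fintype]; exact hcap
        _ = _ := by rw [← ENNReal.ofReal_add (by norm_num) (by norm_num)]; norm_num
    have hgood : 1 / 2 ≤ volume.real (D \ U) := by
      have h1 : volume D ≤ volume (D \ U) + volume U := by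
        refine (measure_mono ?_).trans (measure_union_le _ _)
        rw [Set.sdiff_union_self]; exact Set.subset_union_left
      have hfin : volume (D \ U) ≠ ⊤ :=
        ne_top_of_le_ne_top (by rw [hDv]; simp) (measure_mono Set.sdiff_subset)
      have h2 : (1 : ENNReal) ≤ volume (D \ U) + ENNReal.ofReal (1 / 2) := by
        rw [← hDv]; exact h1.trans (by gcongr)
      have h3 := ENNReal.toReal_mono (by simp [hfin]) h2
      rw [ENNReal.toReal_add hfin (by simp), ENNReal.toReal_ofReal (by norm_num),
        ENNReal.toReal_one] at h3
      unfold Measure.real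
      linarith
    have hlow : ∀ y ∈ D \ U, β * m ^ 2 / (4 * R) ≤ f y := by
      rintro y ⟨hyD, hyU⟩
      simp only [hU, Set.mem_union, Set.mem_iUnion, not_or, not_exists] at hyU
      obtain ⟨hy1, hy2⟩ := hyU
      have hy1 : m * d ≤ ‖y‖ ^ 2 := not_lt.1 hy1
      have hy2 : ∀ i, inner ℝ (pts i) y ≤ m * d / 2 := fun i => by
        by_contra! h
        exact hy2 i ⟨hyD, h.le⟩
      have hKin : K ⊆ {z | inner ℝ z y ≤ m * d / 2} := by
        refine convexHull_min ?_ ?_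
        · rintro z (rfl | ⟨i, rfl⟩)
          · show inner ℝ 0 y ≤ m * d / 2
            rw [inner_zero_left]; positivity
          · exact hy2 i
        · exact convex_halfSpace_le (𝕜 := ℝ) (f := fun z => inner ℝ z y)
            ⟨fun u v => inner_add_left _ _ _, fun c u => by simp [inner_smul_left]⟩ _
      have hz : inner ℝ (P y) y ≤ m * d / 2 := hKin (hP y)
      have h1 : m * d / 2 ≤ ‖y - P y‖ * ‖y‖ := by
        refine le_trans ?_ (real_inner_le_norm _ _)
        rw [inner_sub_left, real_inner_self_eq_norm_sq]
        linarith
      have h2 : (m * d / 2) ^ 2 ≤ ‖y - P y‖ ^ 2 * (R * d) := by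
        calc (m * d / 2) ^ 2 ≤ (‖y - P y‖ * ‖y‖) ^ 2 := by gcongr
          _ = ‖y - P y‖ ^ 2 * ‖y‖ ^ 2 := by ring
          _ ≤ _ := by have := hDR y hyD; gcongr
      have h3 : m ^ 2 * d / (4 * R) ≤ ‖y - P y‖ ^ 2 := by
        rw [div_le_iff₀ (by positivity)]
        have : d * (m ^ 2 * d) ≤ d * (‖y - P y‖ ^ 2 * (4 * R)) := by nlinarith
        exact le_of_mul_le_mul_left this hd'
      calc β * m ^ 2 / (4 * R) = β / d * (m ^ 2 * d / (4 * R)) := by field_simp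
        _ ≤ f y := by rw [hf]; simp only; gcongr
    have hfint : IntegrableOn f D := by
      refine Measure.integrableOn_of_bounded (M := 1) (by rw [hDv]; simp)
        hcd.continuous.aestronglyMeasurable ?_
      refine (ae_restrict_iff' hDm).2 (Eventually.of_forall fun x hx => ?_)
      exact hf1 x hx
    calc β * m ^ 2 / (4 * R) / 2 = β * m ^ 2 / (4 * R) * (1 / 2) := by ring
      _ ≤ β * m ^ 2 / (4 * R) * volume.real (D \ U) := by
          gcongr
      _ ≤ ∫ x in D \ U, f x := by
          refine setIntegral_ge_of_const_le_real (hDm.diff hUm) ?_ hlow (hfint.mono_set Set.sdiff_subset)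
          exact ne_top_of_le_ne_top (by rw [hDv]; simp) (measure_mono Set.sdiff_subset)
      _ ≤ ∫ x in D, f x := by
          refine setIntegral_mono_set hfint (Eventually.of_forall fun x => hf0 x)
            (Eventually.of_forall Set.sdiff_subset)

theorem stmt12 (p : ℝ) (hp : 2 ≤ p)
    (A B : ℕ → ℝ) (hA : ∀ d, 0 < A d) (hB : ∀ d, 0 < B d)
    -- `limsup_{d→∞} min{√d·A_d, d·B_d} > 0`:
    (hlimsup : ∃ ρ > (0 : ℝ), ∃ᶠ d : ℕ in atTop,
      ρ ≤ min (Real.sqrt d * A d) (d * B d)) :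
    ∃ c > (0 : ℝ), ∃ γ > (0 : ℝ), ∃ ε₀ ∈ Set.Ioo (0 : ℝ) 1,
      ∃ᶠ d : ℕ in atTop,
        ∀ n : ℕ, (n : ℝ) < c * (1 + γ) ^ d →
          ∀ pts : Fin n → EuclideanSpace ℝ (Fin d),
            (∀ i, pts i ∈ lpNormalizedBall d p) →
            ∀ φ : (Fin n → ℝ) → ℝ,
              ∃ f : EuclideanSpace ℝ (Fin d) → ℝ,
                MemC1Class d (A d) (B d) (lpNormalizedBall d p) f ∧
                ε₀ ≤ |(∫ x in lpNormalizedBall d p, f x) - φ (fun i => f (pts i))| := by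
  obtain ⟨ρ, hρ, hfreq⟩ := hlimsup
  have hp0 : 0 < p := by linarith
  have hG : 0 < Real.Gamma (1 / p + 1) := Real.Gamma_pos_of_pos (by positivity)
  have hintg := int_g p hp
  have hfacts := fun d hd => alpha_facts d hd p hp
  set a := Real.exp 1 * (2 * Real.Gamma (1 / p + 1)) ^ p with ha_def
  have ha : 0 < a := by positivity
  obtain ⟨C, hC0, hC⟩ := subgauss p hp a ha
  rw [hintg] at hC
  set m := 1 / (16 * Real.exp 1 ^ 2 * Real.pi) with hm_def
  have hpi := Real.pi_pos
  have hm : 0 < m := by positivity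
  set R := 1 + 2 / (p * a) with hR_def
  have hR : 1 ≤ R := by
    have : 0 < 2 / (p * a) := by positivity
    linarith
  have hR0 : 0 < R := by linarith
  set l := m / (4 * C * R) with hl_def
  have hl : 0 < l := by positivity
  set g := m ^ 2 / (32 * C * R) with hg_def
  have hg : 0 < g := by positivity
  set η := min 1 (p * g) with hη_def
  have hη : 0 < η := lt_min one_pos (by positivity)
  have hη1 : η ≤ 1 := min_le_left _ _
  have hηg : η / p ≤ g := by
    rw [div_le_iff₀ hp0, mul_comm]; exact min_le_right _ _
  set β := min (1 / R) (ρ / (2 * R)) with hβ_def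
  have hβ : 0 < β := lt_min (by positivity) (by positivity)
  have hβ1 : β * R ≤ 1 := by
    rw [← le_div_iff₀ hR0]; exact min_le_left _ _
  have hβ2 : 2 * β * R ≤ ρ := by
    have : β ≤ ρ / (2 * R) := min_le_right _ _
    rw [le_div_iff₀ (by positivity)] at this
    linarith
  set ε := β * m ^ 2 / (4 * R) / 2 with hε_def
  have hε : 0 < ε := by positivity
  refine ⟨1 / 4, by norm_num, Real.exp g - 1, by linarith [Real.add_one_le_exp g],
    min ε (1 / 2), ⟨lt_min hε (by norm_num),
      lt_of_le_of_lt (min_le_right _ _) (by norm_num)⟩, ?_⟩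
  have hev : ∀ᶠ d : ℕ in atTop, Real.exp 1 * Real.Gamma ((d : ℝ) / p + 1) ^ (1 / ((d : ℝ) / p))
      ≤ (1 + η) * ((d : ℝ) / p) := by
    have ht : Tendsto (fun d : ℕ => (d : ℝ) / p) atTop atTop :=
      tendsto_natCast_atTop_atTop.atTop_div_const hp0
    exact ht.eventually (gamma_root η hη)
  refine (hfreq.and_eventually (hev.and (eventually_gt_atTop 0))).mono ?_
  rintro d ⟨hρd, hΓ, hd⟩ n hn pts hpts φ
  have hd' : (0 : ℝ) < d := by exact_mod_cast hd
  obtain ⟨hα, hvol, hmeas, hsum, hαeq⟩ := hfacts d hd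
  rw [← hαeq] at hΓ
  have hL2 : alphadp d p ^ p ≤ 2 / (p * a) * d := by
    have h1 : a * alphadp d p ^ p ≤ 2 * (d / p) := hΓ.trans (by gcongr; linarith)
    rw [mul_comm, ← le_div_iff₀ ha] at h1
    refine h1.trans (le_of_eq ?_)
    field_simp
  have hDR : ∀ x ∈ lpNormalizedBall d p, ‖x‖ ^ 2 ≤ R * d := by
    intro x hx
    rw [EuclideanSpace.norm_sq_eq]
    have h1 : ∀ i ∈ Finset.univ, ‖x i‖ ^ 2 ≤ 1 + |x i| ^ p := by
      intro i _
      rw [Real.norm_eq_abs]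
      rcases le_total |x i| 1 with h | h
      · have : |x i| ^ 2 ≤ 1 := pow_le_one₀ (abs_nonneg _) h
        have := Real.rpow_nonneg (abs_nonneg (x i)) p
        linarith
      · have := Real.rpow_le_rpow_of_exponent_le h hp
        rw [Real.rpow_two] at this
        linarith
    refine (Finset.sum_le_sum h1).trans ?_
    rw [Finset.sum_add_distrib]
    have := hsum x hx
    simp only [Finset.sum_const, Finset.card_univ, Fintype.card_fin, nsmul_eq_mul, mul_one]
    rw [hR_def, add_mul, one_mul]
    linarith
  have hcap1 : ∀ i, volume {y ∈ lpNormalizedBall d p | m * d / 2 ≤ inner ℝ (pts i) y} ≤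
      ENNReal.ofReal (Real.exp (-(g * d))) := by
    intro i
    refine (cap_bound p a C (-(1 / p)) hC ha d _ _ hsum (pts i) l (m * d / 2) hl.le).trans
      (ENNReal.ofReal_le_ofReal (Real.exp_le_exp.2 ?_))
    have h1 : C * l ^ 2 * ‖pts i‖ ^ 2 ≤ C * l ^ 2 * (R * d) := by
      have := hDR _ (hpts i); gcongr
    have h2 : C * l ^ 2 * (R * d) - l * (m * d / 2) = -(2 * g) * d := by
      rw [hl_def, hg_def]; field_simp; ring
    have h3 : (1 + η) * ((d : ℝ) / p) + d * -(1 / p) = η / p * d := by field_simp; ring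
    have h4 : η / p * d ≤ g * d := by gcongr
    linarith
  have hcap : ∑ i, volume {y ∈ lpNormalizedBall d p | m * d / 2 ≤ inner ℝ (pts i) y} ≤
      ENNReal.ofReal (1 / 4) := by
    refine (Finset.sum_le_sum fun i _ => hcap1 i).trans ?_
    rw [Finset.sum_const, Finset.card_univ, Fintype.card_fin, nsmul_eq_mul,
      ← ENNReal.ofReal_natCast, ← ENNReal.ofReal_mul (by positivity)]
    apply ENNReal.ofReal_le_ofReal
    have e : (1 + (Real.exp g - 1)) ^ d = Real.exp (g * d) := by
      rw [show 1 + (Real.exp g - 1) = Real.exp g by ring, ← Real.exp_nat_mul, mul_comm]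
    rw [e] at hn
    calc (n : ℝ) * Real.exp (-(g * d)) ≤ 1 / 4 * Real.exp (g * d) * Real.exp (-(g * d)) := by
          gcongr
      _ = 1 / 4 := by rw [mul_assoc, ← Real.exp_add]; simp
  obtain ⟨f, hf1, hf2, hf0, hfI⟩ := fooling d hd (lpNormalizedBall d p) hmeas hvol R m ρ
    (A d) (B d) hR hm hρ hDR (hρd.trans (min_le_left _ _)) (hρd.trans (min_le_right _ _)) n pts
    (small_ball d hd) hcap β hβ hβ1 hβ2
  have e1 : (fun i => f (pts i)) = fun _ => (0 : ℝ) := funext hf0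
  have e2 : (fun i => (fun x => - f x) (pts i)) = fun _ => (0 : ℝ) := by
    funext i; simp [hf0]
  have hε1 : min ε (1 / 2) ≤ ∫ x in lpNormalizedBall d p, f x := (min_le_left _ _).trans hfI
  rcases le_total (φ fun _ => 0) 0 with h | h
  · refine ⟨f, hf1, ?_⟩
    rw [e1]
    exact le_trans (by linarith) (le_abs_self _)
  · refine ⟨fun x => - f x, hf2, ?_⟩
    rw [e2, integral_neg]
    exact le_trans (by linarith) (neg_le_abs _)


end
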